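/- arXiv:1712.03030 — 2 statements merged into one kernel-verified Lean document; each statement's English description precedes it below -/
import Mathlib

section
/- Let 1 ≤ p < ∞, t₀ > 0, k ≥ 1, let c be a nonzero real number, let ν be a finite Borel measure on ℝ, and let f : ℝ → ℂ^k be measurable. Then ∫_{t ∈ [0,t₀]} ( ∫_ℝ ‖f(s + c·t)‖ dν(s) )^p dt ≤ ν(ℝ)^p · |c|⁻¹ · ∫_ℝ ‖f(r)‖^p dr, where both sides are Lebesgue lower integrals of [0,∞]-valued functions. -/
open MeasureTheory
open scoped ENNReal

lemma aux_holder (p : ℝ) (hp : 1 ≤ p) (ν : Measure ℝ) (g : ℝ → ℝ≥0∞) (hg : Measurable g) :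
    (∫⁻ s, g s ∂ν) ^ p ≤ (ν Set.univ) ^ (p - 1) * ∫⁻ s, g s ^ p ∂ν := by
  rcases hp.eq_or_lt with rfl | hp
  · simp
  have hp0 : 0 < p := by linarith
  have hpq : p.HolderConjugate (p.conjExponent) := Real.HolderConjugate.conjExponent hp
  have h := ENNReal.lintegral_mul_le_Lp_mul_Lq ν hpq hg.aemeasurable
    (aemeasurable_const (b := (1 : ℝ≥0∞)))
  simp only [Pi.mul_apply, mul_one, ENNReal.one_rpow, lintegral_const, one_mul] at h
  have h2 := ENNReal.rpow_le_rpow h hp0.le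
  rw [ENNReal.mul_rpow_of_nonneg _ _ hp0.le, ← ENNReal.rpow_mul, ← ENNReal.rpow_mul,
    one_div_mul_cancel hp0.ne', ENNReal.rpow_one] at h2
  have e : 1 / p.conjExponent * p = p - 1 := by
    have : p - 1 ≠ 0 := by linarith
    unfold Real.conjExponent
    field_simp
  rw [e, mul_comm] at h2
  exact h2

lemma aux_shift (c : ℝ) (hc : c ≠ 0) (s : ℝ) (g : ℝ → ℝ≥0∞) (hg : Measurable g) :
    ∫⁻ t, g (s + c * t) = ENNReal.ofReal |c|⁻¹ * ∫⁻ r, g r := by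
  have h1 : ∫⁻ t, g (s + c * t) = ∫⁻ u, g (s + u) ∂(Measure.map (c * ·) volume) := by
    rw [lintegral_map (by fun_prop) (by fun_prop)]
  rw [h1, Real.map_volume_mul_left hc, lintegral_smul_measure, lintegral_add_left_eq_self g s,
    abs_inv, smul_eq_mul]

/-- The p-admissibility estimate for a boundary functional represented by a
finite Borel measure `ν` with respect to the shift semigroups of speed `c ≠ 0`:
`∫_{[0,t₀]} (∫ ‖f(s + c·t)‖ dν(s))^p dt ≤ ν(ℝ)^p · |c|⁻¹ · ∫ ‖f(r)‖^p dr`. -/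
theorem stmt9 (p : ℝ) (hp : 1 ≤ p) (t₀ : ℝ) (ht₀ : 0 < t₀) {k : ℕ} (hk : 1 ≤ k)
    (c : ℝ) (hc : c ≠ 0)
    (ν : Measure ℝ) [IsFiniteMeasure ν]
    (f : ℝ → (Fin k → ℂ)) (hf : Measurable f) :
    ∫⁻ t in Set.Icc (0:ℝ) t₀, (∫⁻ s, (‖f (s + c * t)‖₊ : ℝ≥0∞) ∂ν) ^ p
      ≤ (ν Set.univ) ^ p * ENNReal.ofReal |c|⁻¹ * ∫⁻ r, (‖f r‖₊ : ℝ≥0∞) ^ p := by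
  have hg : Measurable (fun r => (‖f r‖₊ : ℝ≥0∞)) := by fun_prop
  have hgp : Measurable (fun r => (‖f r‖₊ : ℝ≥0∞) ^ p) := hg.pow_const p
  calc ∫⁻ t in Set.Icc (0:ℝ) t₀, (∫⁻ s, (‖f (s + c * t)‖₊ : ℝ≥0∞) ∂ν) ^ p
      ≤ ∫⁻ t, (∫⁻ s, (‖f (s + c * t)‖₊ : ℝ≥0∞) ∂ν) ^ p := setLIntegral_le_lintegral _ _
    _ ≤ ∫⁻ t, (ν Set.univ) ^ (p - 1) * ∫⁻ s, (‖f (s + c * t)‖₊ : ℝ≥0∞) ^ p ∂ν :=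
        lintegral_mono fun t => aux_holder p hp ν _ (hg.comp (measurable_id.add_const (c * t)))
    _ = (ν Set.univ) ^ (p - 1) * ∫⁻ t, ∫⁻ s, (‖f (s + c * t)‖₊ : ℝ≥0∞) ^ p ∂ν :=
        lintegral_const_mul' _ _
          (ENNReal.rpow_ne_top_of_nonneg (by linarith) (measure_ne_top _ _))
    _ = (ν Set.univ) ^ (p - 1) * ∫⁻ s, (∫⁻ t, (‖f (s + c * t)‖₊ : ℝ≥0∞) ^ p) ∂ν := by
        rw [lintegral_lintegral_swap]
        exact (hgp.comp (g := fun r => (‖f r‖₊ : ℝ≥0∞) ^ p)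
          (f := fun x : ℝ × ℝ => x.2 + c * x.1) (by fun_prop)).aemeasurable
    _ = (ν Set.univ) ^ (p - 1) *
          ∫⁻ s, (ENNReal.ofReal |c|⁻¹ * ∫⁻ r, (‖f r‖₊ : ℝ≥0∞) ^ p) ∂ν := by
        congr 1
        exact lintegral_congr fun s => aux_shift c hc s _ hgp
    _ = _ := by
        have e : (ν Set.univ) ^ p = (ν Set.univ) ^ (p - 1) * ν Set.univ := by
          conv_rhs => rw [← ENNReal.rpow_one (ν Set.univ), ← ENNReal.rpow_mul, one_mul]
          rw [← ENNReal.rpow_add_of_nonneg _ _ (by linarith) zero_le_one]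
          simp
        rw [lintegral_const, e]
        ring
end

section
/- For every λ ∈ ℂ there exists an infinitely differentiable function f : ℝ → ℂ which is not identically zero on [0,1], such that f″(s) = λ·f(s) for all s ∈ ℝ, f(0) + f(1) = 0, and f′(0) = f′(1). (Hence every λ ∈ ℂ is an eigenvalue of the second derivative operator G₁ = d²/ds² on L^p[0,1] with domain {f ∈ W^{2,p}[0,1] : f(0)+f(1)=0, f′(0)−f′(1)=0}, so σ(G₁) = ℂ and G₁ is not a generator.) -/
/-- Every `λ ∈ ℂ` is an eigenvalue of `d²/ds²` subject to the boundary
conditions `f(0) + f(1) = 0` and `f′(0) = f′(1)`: there is a smooth `f : ℝ → ℂ`, not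
identically zero on `[0,1]`, with `f″ = λ·f`, `f(0) + f(1) = 0` and `f′(0) = f′(1)`. -/
theorem stmt12 (l : ℂ) :
    ∃ f : ℝ → ℂ, ContDiff ℝ (⊤ : ℕ∞) f ∧ (∃ s ∈ Set.Icc (0:ℝ) 1, f s ≠ 0) ∧
      (∀ s : ℝ, deriv (deriv f) s = l * f s) ∧
      f 0 + f 1 = 0 ∧ deriv f 0 = deriv f 1 := by
  have hof : ∀ s : ℝ, HasDerivAt (fun s : ℝ => (s : ℂ)) 1 s := fun s =>
    (hasDerivAt_id s).ofReal_comp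
  have hsm : ContDiff ℝ (⊤ : ℕ∞) (fun s : ℝ => (s : ℂ)) := Complex.ofRealCLM.contDiff
  by_cases hl : l = 0
  · subst hl
    have hd : deriv (fun s : ℝ => (s : ℂ) - 1 / 2) = fun _ => 1 := by
      funext s
      exact ((hof s).sub_const _).deriv
    refine ⟨fun s => (s : ℂ) - 1 / 2, hsm.sub contDiff_const,
      ⟨0, by simp, by simp⟩, ?_, ?_, ?_⟩
    · intro s
      rw [hd]
      simp
    · norm_num
    · rw [hd]
  · obtain ⟨m, hm⟩ := IsAlgClosed.exists_pow_nat_eq l (n := 2) (by norm_num)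
    have hm0 : m ≠ 0 := by
      rintro rfl
      apply hl
      rw [← hm]
      norm_num
    have h1 : ∀ s : ℝ, HasDerivAt (fun s : ℝ => Complex.exp (m * s))
        (m * Complex.exp (m * s)) s := fun s => by
      convert ((hof s).const_mul m).cexp using 1
      ring
    have h2 : ∀ s : ℝ, HasDerivAt (fun s : ℝ => Complex.exp (m * (1 - s)))
        (-(m * Complex.exp (m * (1 - s)))) s := fun s => by
      convert (((hof s).const_sub 1).const_mul m).cexp using 1
      ring
    have hd : deriv (fun s : ℝ => Complex.exp (m * s) - Complex.exp (m * (1 - s))) =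
        fun s : ℝ => m * Complex.exp (m * s) + m * Complex.exp (m * (1 - s)) := by
      funext s
      rw [((h1 s).fun_sub (h2 s)).deriv]
      ring
    refine ⟨fun s => Complex.exp (m * s) - Complex.exp (m * (1 - s)), ?_, ?_, ?_, ?_, ?_⟩
    · exact (contDiff_const.mul hsm).cexp.sub (contDiff_const.mul (contDiff_const.sub hsm)).cexp
    · by_contra! h
      have he : (fun s : ℝ => Complex.exp (m * s) - Complex.exp (m * (1 - s)))
          =ᶠ[nhds (1 / 2 : ℝ)] fun _ => 0 := by
        filter_upwards [Icc_mem_nhds (a := (0 : ℝ)) (b := 1) (x := 1 / 2)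
          (by norm_num) (by norm_num)] with s hs using h s hs
      have h3 := he.deriv_eq
      rw [hd] at h3
      have h4 : (1 - ((1 / 2 : ℝ) : ℂ)) = ((1 / 2 : ℝ) : ℂ) := by
        push_cast
        norm_num
      simp only [h4, deriv_const, ← two_mul] at h3
      simp [hm0, Complex.exp_ne_zero] at h3
    · intro s
      rw [hd, (((h1 s).const_mul m).fun_add ((h2 s).const_mul m)).deriv, ← hm]
      ring
    · simp
    · rw [hd]
      simp [add_comm]
end
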